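/- arXiv:1002.1584 — 6 statements merged into one kernel-verified Lean document; each statement's English description precedes it below -/
import Mathlib

section
/- Let x₀ > 0 be a real number and set λ = x₀/(1+x₀). Then for every real x ≥ 0, one has 1 + x ≥ ((1+x₀)/x₀^λ) · x^λ, where powers are real powers. -/
/-- Tangent-type inequality: for `x₀ > 0`, `λ = x₀/(1+x₀)`, and every `x ≥ 0`,
`1 + x ≥ ((1+x₀)/x₀^λ) · x^λ` (real powers). -/
theorem stmt_0 (x₀ : ℝ) (hx₀ : 0 < x₀) (lam : ℝ) (hlam : lam = x₀ / (1 + x₀))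
    (x : ℝ) (hx : 0 ≤ x) :
    ((1 + x₀) / x₀ ^ lam) * x ^ lam ≤ 1 + x := by
  have hpos : 0 < 1 + x₀ := by positivity
  have hlam_nonneg : 0 ≤ lam := by rw [hlam]; positivity
  have hsum : lam + 1 / (1 + x₀) = 1 := by rw [hlam]; field_simp; ring
  have amgm := Real.geom_mean_le_arith_mean2_weighted hlam_nonneg (by positivity)
    (div_nonneg hx hx₀.le) zero_le_one hsum
  rw [Real.one_rpow, mul_one, Real.div_rpow hx hx₀.le] at amgm
  calc (1 + x₀) / x₀ ^ lam * x ^ lam = (1 + x₀) * (x ^ lam / x₀ ^ lam) := by ring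
    _ ≤ (1 + x₀) * (lam * (x / x₀) + 1 / (1 + x₀) * 1) := by gcongr
    _ = 1 + x := by rw [hlam]; field_simp; ring
end

section
/- Let x₀ > 0, λ = x₀/(1+x₀), and let x ≥ 0 be a real number. Then 1 + x = ((1+x₀)/x₀^λ) · x^λ if and only if x = x₀. -/
/-- Equality case of the tangent-type inequality: for `x₀ > 0`, `λ = x₀/(1+x₀)`
and `x ≥ 0`, one has `1 + x = ((1+x₀)/x₀^λ) · x^λ` iff `x = x₀`. -/
theorem stmt_6 (x₀ : ℝ) (hx₀ : 0 < x₀) (lam : ℝ) (hlam : lam = x₀ / (1 + x₀))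
    (x : ℝ) (hx : 0 ≤ x) :
    1 + x = ((1 + x₀) / x₀ ^ lam) * x ^ lam ↔ x = x₀ := by
  have hpos : 0 < 1 + x₀ := by positivity
  constructor
  · intro h
    by_contra hne
    have hs : x / x₀ - 1 ≠ 0 := by
      rwa [sub_ne_zero, Ne, div_eq_one_iff_eq hx₀.ne']
    have hs' : -1 ≤ x / x₀ - 1 := by
      have : 0 ≤ x / x₀ := by positivity
      linarith
    have hlam_pos : 0 < lam := by rw [hlam]; positivity
    have hlam_lt : lam < 1 := by rw [hlam, div_lt_one hpos]; linarith
    have bernoulli := rpow_one_add_lt_one_add_mul_self hs' hs hlam_pos hlam_lt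
    have tangent : 1 + lam * (x / x₀ - 1) = (1 + x) / (1 + x₀) := by
      rw [hlam]
      field_simp
      ring
    rw [add_sub_cancel, tangent, Real.div_rpow hx hx₀.le, lt_div_iff₀ hpos, h] at bernoulli
    exact bernoulli.ne (by ring)
  · rintro rfl
    exact (div_mul_cancel₀ _ (Real.rpow_pos_of_pos hx₀ lam).ne').symm
end

section
/- Let n be a natural number and let x, x₀ : Fin n → ℝ with x i > 0 and x₀ i > 0 for all i. Set λᵢ = x₀ i/(1 + x₀ i) for each i. Then ∏ᵢ (1 + x i) ≥ ∏ᵢ ((1 + x₀ i)/(x₀ i)^{λᵢ}) · (x i)^{λᵢ}. -/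
/-- The function `t ↦ 1 + t` dominates on the positive half-line its best monomial
approximation at `t₀`. -/
theorem monomial_le_one_add {t t₀ : ℝ} (ht : 0 < t) (ht₀ : 0 < t₀) :
    (1 + t₀) / t₀ ^ (t₀ / (1 + t₀)) * t ^ (t₀ / (1 + t₀)) ≤ 1 + t := by
  have h₀ : 0 < 1 + t₀ := by positivity
  have amgm := Real.geom_mean_le_arith_mean2_weighted (w₁ := t₀ / (1 + t₀))
    (w₂ := 1 / (1 + t₀)) (p₁ := t / t₀) (p₂ := 1) (by positivity) (by positivity)
    (by positivity) zero_le_one (by field_simp; ring)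
  rw [Real.one_rpow, mul_one, Real.div_rpow ht.le ht₀.le] at amgm
  calc (1 + t₀) / t₀ ^ (t₀ / (1 + t₀)) * t ^ (t₀ / (1 + t₀))
      = (1 + t₀) * (t ^ (t₀ / (1 + t₀)) / t₀ ^ (t₀ / (1 + t₀))) := by ring
    _ ≤ (1 + t₀) * (t₀ / (1 + t₀) * (t / t₀) + 1 / (1 + t₀) * 1) := by gcongr
    _ = 1 + t := by field_simp; ring

/-- Product form of the monomial minorization: for positive `x, x₀ : Fin n → ℝ`
and `λᵢ = x₀ i / (1 + x₀ i)`,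
`∏ᵢ (1 + x i) ≥ ∏ᵢ ((1 + x₀ i)/(x₀ i)^{λᵢ}) · (x i)^{λᵢ}`. -/
theorem stmt_7 (n : ℕ) (x x₀ : Fin n → ℝ)
    (hx : ∀ i, 0 < x i) (hx₀ : ∀ i, 0 < x₀ i)
    (lam : Fin n → ℝ) (hlam : ∀ i, lam i = x₀ i / (1 + x₀ i)) :
    ∏ i, ((1 + x₀ i) / (x₀ i) ^ lam i) * (x i) ^ lam i ≤ ∏ i, (1 + x i) := by
  refine Finset.prod_le_prod (fun i _ => ?_) (fun i _ => ?_)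
  · have := hx i
    have := hx₀ i
    positivity
  · rw [hlam i]
    exact monomial_le_one_add (hx i) (hx₀ i)
end

section
/- Let n be a natural number and let x, x₀ : Fin n → ℝ with x i > 0 and x₀ i > 0 for all i. Set λᵢ = x₀ i/(1 + x₀ i) and c = (∏ᵢ (1 + x₀ i)) / (∏ᵢ (x₀ i)^{λᵢ}). Then ∑ᵢ log(1 + x i) ≥ log c + ∑ᵢ λᵢ · log(x i). -/
/-- The tangent-line (monomial) lower bound for `log (1 + x)` at the point `a`, in the
variable `log x`. -/
theorem log_one_add_ge_monomial {a x : ℝ} (ha : 0 < a) (hx : 0 < x) :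
    Real.log (1 + a) - a / (1 + a) * Real.log a + a / (1 + a) * Real.log x
      ≤ Real.log (1 + x) := by
  have h1a : 0 < 1 + a := by positivity
  have hconc := strictConcaveOn_log_Ioi.concaveOn.2
    (Set.mem_Ioi.2 (div_pos hx ha)) (Set.mem_Ioi.2 one_pos)
    (div_pos ha h1a).le (div_pos one_pos h1a).le (by field_simp; ring)
  have hmean : a / (1 + a) * (x / a) + 1 / (1 + a) * 1 = (1 + x) / (1 + a) := by
    field_simp
    ring
  simp only [smul_eq_mul] at hconc
  rw [hmean, Real.log_one, mul_zero, add_zero, Real.log_div hx.ne' ha.ne',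
    Real.log_div (by positivity) h1a.ne'] at hconc
  linarith

/-- Logarithmic form: for positive `x, x₀ : Fin n → ℝ`, `λᵢ = x₀ i/(1 + x₀ i)` and
`c = (∏ᵢ (1 + x₀ i)) / (∏ᵢ (x₀ i)^{λᵢ})`, one has
`∑ᵢ log(1 + x i) ≥ log c + ∑ᵢ λᵢ · log(x i)`. -/
theorem stmt_8 (n : ℕ) (x x₀ : Fin n → ℝ)
    (hx : ∀ i, 0 < x i) (hx₀ : ∀ i, 0 < x₀ i)
    (lam : Fin n → ℝ) (hlam : ∀ i, lam i = x₀ i / (1 + x₀ i))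
    (c : ℝ) (hc : c = (∏ i, (1 + x₀ i)) / ∏ i, (x₀ i) ^ lam i) :
    Real.log c + ∑ i, lam i * Real.log (x i) ≤ ∑ i, Real.log (1 + x i) := by
  have hlogc : Real.log c = ∑ i, (Real.log (1 + x₀ i) - lam i * Real.log (x₀ i)) := by
    have hnum : ∀ i, 1 + x₀ i ≠ 0 := fun i => (add_pos one_pos (hx₀ i)).ne'
    have hden : ∀ i, x₀ i ^ lam i ≠ 0 := fun i => (Real.rpow_pos_of_pos (hx₀ i) _).ne'
    rw [hc, Real.log_div (Finset.prod_ne_zero_iff.2 fun i _ => hnum i)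
      (Finset.prod_ne_zero_iff.2 fun i _ => hden i),
      Real.log_prod fun i _ => hnum i, Real.log_prod fun i _ => hden i,
      Finset.sum_sub_distrib]
    simp only [Real.log_rpow (hx₀ _)]
  rw [hlogc, ← Finset.sum_add_distrib]
  refine Finset.sum_le_sum fun i _ => ?_
  rw [hlam i]
  exact log_one_add_ge_monomial (hx₀ i) (hx i)
end

section
/- Let n be a natural number, let x₀ : Fin n → ℝ with x₀ i > 0 for all i, set λᵢ = x₀ i/(1 + x₀ i) and c = (∏ᵢ (1 + x₀ i)) / (∏ᵢ (x₀ i)^{λᵢ}). Define f₀, f̃₀ : (Fin n → ℝ) → ℝ by f₀(x) = ∏ᵢ (1 + x i) and f̃₀(x) = c · ∏ᵢ (x i)^{λᵢ}. Then f̃₀(x₀) = f₀(x₀) and the Fréchet derivatives of f₀ and f̃₀ at x₀ coincide: fderiv ℝ f₀ x₀ = fderiv ℝ f̃₀ x₀. -/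
/-- Logarithmic form of the product rule: the derivative of a finite product of nonvanishing
functions is the product times the sum of the logarithmic derivatives. -/
theorem hasFDerivAt_finsetProd_of_ne_zero {ι 𝕜 E : Type*} [NontriviallyNormedField 𝕜]
    [NormedAddCommGroup E] [NormedSpace 𝕜 E] {s : Finset ι} {g : ι → E → 𝕜}
    {g' : ι → E →L[𝕜] 𝕜} {x : E} (hg : ∀ i ∈ s, HasFDerivAt (g i) (g' i) x)
    (h0 : ∀ i ∈ s, g i x ≠ 0) :
    HasFDerivAt (fun y => ∏ i ∈ s, g i y) ((∏ i ∈ s, g i x) • ∑ i ∈ s, (g i x)⁻¹ • g' i) x := by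
  classical
  refine (HasFDerivAt.finsetProd hg).congr_fderiv ?_
  rw [Finset.smul_sum]
  refine Finset.sum_congr rfl fun i hi => ?_
  rw [smul_smul, ← Finset.prod_erase_mul s _ hi, mul_inv_cancel_right₀ (h0 i hi)]

/-- Value- and gradient-matching of the monomial approximation: with
`λᵢ = x₀ i/(1 + x₀ i)` and `c = (∏ᵢ (1+x₀ i)) / (∏ᵢ (x₀ i)^{λᵢ})`, the functions
`f₀(x) = ∏ᵢ (1 + x i)` and `f̃₀(x) = c · ∏ᵢ (x i)^{λᵢ}` satisfy `f̃₀(x₀) = f₀(x₀)` and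
`fderiv ℝ f₀ x₀ = fderiv ℝ f̃₀ x₀`. -/
theorem stmt_9 (n : ℕ) (x₀ : Fin n → ℝ) (hx₀ : ∀ i, 0 < x₀ i)
    (lam : Fin n → ℝ) (hlam : ∀ i, lam i = x₀ i / (1 + x₀ i))
    (c : ℝ) (hc : c = (∏ i, (1 + x₀ i)) / ∏ i, (x₀ i) ^ lam i)
    (f₀ ftilde₀ : (Fin n → ℝ) → ℝ)
    (hf₀ : ∀ x, f₀ x = ∏ i, (1 + x i))
    (hftilde₀ : ∀ x, ftilde₀ x = c * ∏ i, (x i) ^ lam i) :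
    ftilde₀ x₀ = f₀ x₀ ∧ fderiv ℝ f₀ x₀ = fderiv ℝ ftilde₀ x₀ := by
  have hpow : ∀ i, x₀ i ^ lam i ≠ 0 := fun i => (Real.rpow_pos_of_pos (hx₀ i) _).ne'
  have hone : ∀ i, 1 + x₀ i ≠ 0 := fun i => (add_pos one_pos (hx₀ i)).ne'
  have hval : c * ∏ i, x₀ i ^ lam i = ∏ i, (1 + x₀ i) := by
    rw [hc, div_mul_cancel₀ _ (Finset.prod_ne_zero_iff.mpr fun i _ => hpow i)]
  refine ⟨by rw [hftilde₀, hf₀, hval], ?_⟩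
  rw [funext hf₀, funext hftilde₀]
  have hproj : ∀ i, HasFDerivAt (fun x : Fin n → ℝ => x i)
      (ContinuousLinearMap.proj (R := ℝ) (φ := fun _ : Fin n => ℝ) i) x₀ :=
    fun i => hasFDerivAt_apply i x₀
  have hprod := hasFDerivAt_finsetProd_of_ne_zero (s := Finset.univ)
    (fun i _ => (hproj i).const_add 1) fun i _ => hone i
  have hmono := (hasFDerivAt_finsetProd_of_ne_zero (s := Finset.univ)
    (fun i _ => (hproj i).rpow_const (p := lam i) (Or.inl (hx₀ i).ne'))
    fun i _ => hpow i).const_mul c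
  rw [hprod.fderiv, hmono.fderiv, smul_smul, hval]
  congr 1
  refine Finset.sum_congr rfl fun i _ => ?_
  rw [smul_smul]
  congr 1
  rw [Real.rpow_sub_one (hx₀ i).ne', hlam i]
  have hone_i := hone i
  have hx_i := (hx₀ i).ne'
  have hpow_i := hlam i ▸ hpow i
  field_simp
end

section
/- Let n be a natural number, let x₀ : Fin n → ℝ with x₀ i > 0 for all i, and let c > 0 and λ : Fin n → ℝ. Define f₀, f̃₀ : (Fin n → ℝ) → ℝ by f₀(x) = ∏ᵢ (1 + x i) and f̃₀(x) = c · ∏ᵢ (x i)^{λᵢ}. If fderiv ℝ f̃₀ x₀ = fderiv ℝ f₀ x₀ and f̃₀(x₀) = f₀(x₀), then λᵢ = x₀ i/(1 + x₀ i) for every i and c = (∏ᵢ (1 + x₀ i)) / (∏ᵢ (x₀ i)^{λᵢ}). -/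
/-- The Fréchet derivative of a product of functions of separate coordinates. -/
theorem hasFDerivAt_prod_apply {ι : Type*} [Fintype ι] {g : ι → ℝ → ℝ} {g' x : ι → ℝ}
    (hg : ∀ i, HasDerivAt (g i) (g' i) (x i)) (hne : ∀ i, g i (x i) ≠ 0) :
    HasFDerivAt (fun y : ι → ℝ => ∏ i, g i (y i))
      (∑ i, ((∏ k, g k (x k)) * (g' i / g i (x i))) •
        ContinuousLinearMap.proj (R := ℝ) (φ := fun _ : ι => ℝ) i) x := by
  classical
  have h := HasFDerivAt.finsetProd (u := Finset.univ)
    (g := fun i (y : ι → ℝ) => g i (y i)) (x := x) fun i _ =>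
      (hg i).comp_hasFDerivAt x (hasFDerivAt_apply (𝕜 := ℝ) (F' := fun _ : ι => ℝ) i x)
  refine h.congr_fderiv (Finset.sum_congr rfl fun i _ => ?_)
  rw [smul_smul, ← Finset.mul_prod_erase _ _ (Finset.mem_univ i)]
  congr 1
  field_simp [hne i]

/-- Uniqueness of the monomial approximation parameters: if `c > 0` and the monomial
`f̃₀(x) = c · ∏ᵢ (x i)^{λᵢ}` matches `f₀(x) = ∏ᵢ (1 + x i)` in value and Fréchet
derivative at a positive point `x₀`, then `λᵢ = x₀ i/(1 + x₀ i)` for every `i` and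
`c = (∏ᵢ (1 + x₀ i)) / (∏ᵢ (x₀ i)^{λᵢ})`. -/
theorem stmt_10 (n : ℕ) (x₀ : Fin n → ℝ) (hx₀ : ∀ i, 0 < x₀ i)
    (c : ℝ) (hc : 0 < c) (lam : Fin n → ℝ)
    (f₀ ftilde₀ : (Fin n → ℝ) → ℝ)
    (hf₀ : ∀ x, f₀ x = ∏ i, (1 + x i))
    (hftilde₀ : ∀ x, ftilde₀ x = c * ∏ i, (x i) ^ lam i)
    (hderiv : fderiv ℝ ftilde₀ x₀ = fderiv ℝ f₀ x₀)
    (hval : ftilde₀ x₀ = f₀ x₀) :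
    (∀ i, lam i = x₀ i / (1 + x₀ i)) ∧
    c = (∏ i, (1 + x₀ i)) / ∏ i, (x₀ i) ^ lam i := by
  obtain rfl : f₀ = _ := funext hf₀
  obtain rfl : ftilde₀ = _ := funext hftilde₀
  dsimp only at hval
  have hpos (i) : 0 < 1 + x₀ i := by linarith [hx₀ i]
  have hpow (i) : 0 < x₀ i ^ lam i := Real.rpow_pos_of_pos (hx₀ i) _
  refine ⟨fun i => ?_, (eq_div_iff (Finset.prod_pos fun i _ => hpow i).ne').2 hval⟩
  have hone := hasFDerivAt_prod_apply (g := fun _ t => 1 + t) (x := x₀)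
    (fun i => (hasDerivAt_id (x₀ i)).const_add 1) fun i => (hpos i).ne'
  have hmon := (hasFDerivAt_prod_apply (g := fun i t => t ^ lam i) (x := x₀)
    (fun i => Real.hasDerivAt_rpow_const (Or.inl (hx₀ i).ne')) fun i => (hpow i).ne').const_mul c
  rw [hone.fderiv, hmon.fderiv] at hderiv
  have h := DFunLike.congr_fun hderiv (Pi.single i 1)
  simp only [smul_apply, sum_apply,
    ContinuousLinearMap.proj_apply, smul_eq_mul, Pi.single_apply, mul_ite, mul_one, mul_zero,
    Finset.sum_ite_eq', Finset.mem_univ, if_true] at h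
  rw [← mul_assoc, hval] at h
  have h' := mul_left_cancel₀ (Finset.prod_pos fun i _ => hpos i).ne' h
  rw [Real.rpow_sub_one (hx₀ i).ne'] at h'
  have := hx₀ i
  have := hpos i
  have := hpow i
  field_simp at h' ⊢
  linarith
end
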